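/- arXiv:1101.2075 — 2 statements merged into one kernel-verified Lean document; each statement's English description precedes it below -/
import Mathlib

section
/- Let σ : 2^S → ℝ_{>0}, let λ be a shape of W, and let I ∈ S_λ. Then e^σ_λ ℂW = e^σ_I ℂW; that is, the right ideal E^σ_λ of ℂW generated by the idempotent e^σ_λ equals the right ideal generated by the single quasi-idempotent e^σ_I. -/
open scoped Classical
open MonoidAlgebra Finset

noncomputable section

namespace DPR

variable {B : Type} {W : Type} [Group W] [Fintype W] [DecidableEq W]
  {M : CoxeterMatrix B}

/-- The set `S` of simple reflections of the Coxeter system, as a finset of `W`. -/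
def Simples (cs : CoxeterSystem M W) : Finset W :=
  Finset.univ.filter (fun w => ∃ i, cs.simple i = w)

/-- The set `W^I` of minimal length left coset representatives of `W_I`,
computed inside the subset `H` of `W` (take `H = Set.univ` for the absolute case). -/
def minCoset (cs : CoxeterSystem M W) (H : Set W) (I : Finset W) : Finset W :=
  Finset.univ.filter (fun w => w ∈ H ∧ ∀ s ∈ I, cs.length w < cs.length (w * s))

/-- The element `x_I = ∑_{w ∈ W^I} w` of the group algebra `ℂ W`, relative to `H`. -/
def xRel (cs : CoxeterSystem M W) (H : Set W) (I : Finset W) : MonoidAlgebra ℂ W :=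
  ∑ w ∈ minCoset cs H I, of ℂ W w

/-- `w(Δ_J) ⊆ Δ_D`:  for every `s ∈ J`, `wsw⁻¹ ∈ D` and `ℓ(ws) = ℓ(w) + 1`. -/
def Takes (cs : CoxeterSystem M W) (D : Finset W) (w : W) (J : Finset W) : Prop :=
  ∀ s ∈ J, w * s * w⁻¹ ∈ D ∧ cs.length (w * s) = cs.length w + 1

/-- `ᵂJ = wJw⁻¹`. -/
def conjF (w : W) (J : Finset W) : Finset W := J.image (fun s => w * s * w⁻¹)

/-- The coefficient `m^σ_{JK}`, computed relative to the pair `(H, D)`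
(`H = Set.univ`, `D = S` in the absolute case). -/
def mC (cs : CoxeterSystem M W) (H : Set W) (D : Finset W) (σ : Finset W → ℝ)
    (J K : Finset W) : ℝ :=
  if J ⊆ K then
    ∑ w ∈ (minCoset cs H K).filter (fun w => Takes cs D w J), σ (conjF w J)
  else 0

/-- The family `(e_J)` is a family of BBHT quasi-idempotents, relative to `(H, D, σ)`:
it solves the defining triangular system `x_K = ∑_{J ⊆ K} m^σ_{JK} e_J` for all `K ⊆ D`. -/
def IsBBHT (cs : CoxeterSystem M W) (H : Set W) (D : Finset W) (σ : Finset W → ℝ)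
    (e : Finset W → MonoidAlgebra ℂ W) : Prop :=
  ∀ K ∈ D.powerset, xRel cs H K = ∑ J ∈ K.powerset, (mC cs H D σ J K : ℂ) • e J

/-- `σ` takes positive values (on subsets of `D`). -/
def PosOn (D : Finset W) (σ : Finset W → ℝ) : Prop := ∀ I ∈ D.powerset, 0 < σ I

/-- Two subsets of `S` have the same shape if the parabolic subgroups they generate
are conjugate in `W`. -/
def ShapeEq (I J : Finset W) : Prop :=
  ∃ w : W, Subgroup.closure (J : Set W) =
    Subgroup.map (MulAut.conj w).toMonoidHom (Subgroup.closure (I : Set W))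

/-- Solomon's descent algebra, as a subspace of the group algebra: the span of the `x_I`. -/
def descAlg (cs : CoxeterSystem M W) : Submodule ℂ (MonoidAlgebra ℂ W) :=
  Submodule.span ℂ {a | ∃ I ∈ (Simples cs).powerset, a = xRel cs Set.univ I}

end DPR

namespace CoxeterSystem

variable {B W : Type*} [Group W] {M : CoxeterMatrix B} (cs : CoxeterSystem M W)

theorem _root_.Function.End.mul_apply {α : Type*} (f g : Function.End α) (x : α) :
    (f * g) x = f (g x) := rfl

/-- The action of a simple reflection on signed group elements: conjugation, together with a
change of sign exactly at the simple reflection itself. -/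
def signedConj (i : B) : Function.End (W × ZMod 2) := fun p =>
  (cs.simple i * p.1 * cs.simple i, p.2 + if p.1 = cs.simple i then 1 else 0)

theorem signedConj_mul_pow (i j : B) (n : ℕ) (p : W × ZMod 2) :
    ((cs.signedConj i * cs.signedConj j) ^ n) p =
      ((cs.simple i * cs.simple j) ^ n * p.1 * ((cs.simple i * cs.simple j) ^ n)⁻¹,
        p.2 + ∑ k ∈ Finset.range (2 * n),
          if p.1 = cs.simple j * (cs.simple i * cs.simple j) ^ k then 1 else 0) := by
  induction n with
  | zero => simp [Function.End.one_def]
  | succ n ih =>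
    rw [pow_succ', Function.End.mul_apply, ih, Function.End.mul_apply]
    set r := cs.simple i * cs.simple j with hr
    have hrj : ∀ k : ℕ, (r ^ k)⁻¹ * cs.simple j = cs.simple j * r ^ k := by
      intro k
      have h1 : cs.simple j * r * (cs.simple j)⁻¹ = r⁻¹ := by simp [hr, mul_assoc]
      have h2 : cs.simple j * r ^ k * (cs.simple j)⁻¹ = (r ^ k)⁻¹ := by
        rw [← conj_pow, h1, inv_pow]
      rw [← h2]; simp [mul_assoc]
    have key : ∀ x y : W, (r ^ n * x * (r ^ n)⁻¹ = y ↔ x = (r ^ n)⁻¹ * y * r ^ n) := by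
      intro x y
      constructor
      · rintro rfl; simp [mul_assoc]
      · rintro rfl; simp [mul_assoc]
    have e1 : r ^ n * p.1 * (r ^ n)⁻¹ = cs.simple j ↔ p.1 = cs.simple j * r ^ (2 * n) := by
      rw [key, hrj, two_mul, pow_add, mul_assoc]
    have e2 : cs.simple j * (r ^ n * p.1 * (r ^ n)⁻¹) * cs.simple j = cs.simple i ↔
        p.1 = cs.simple j * r ^ (2 * n + 1) := by
      have this : ∀ x : W, cs.simple j * x * cs.simple j = cs.simple i ↔ x = cs.simple j * r := by
        intro x
        constructor
        · intro h; rw [hr, ← h]; simp [mul_assoc]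
        · rintro rfl; simp [hr, mul_assoc]
      rw [this, key, ← mul_assoc, hrj, two_mul, pow_succ, pow_add]
      simp only [mul_assoc, (Commute.refl r).pow_right n |>.eq]
    have e3 : 2 * (n + 1) = 2 * n + 1 + 1 := by ring
    rw [e3, Finset.sum_range_succ, Finset.sum_range_succ]
    simp only [signedConj, e1, e2]
    refine Prod.ext ?_ ?_
    · simp [pow_succ', hr, mul_assoc]
    · simp only [add_assoc]

theorem signedConj_isLiftable : M.IsLiftable cs.signedConj := by
  intro i j
  funext p
  rw [signedConj_mul_pow, cs.simple_mul_simple_pow, two_mul, Finset.sum_range_add]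
  simp only [pow_add, cs.simple_mul_simple_pow, one_mul, CharTwo.add_self_eq_zero]
  simp [Function.End.one_def]

/-- The action of the group on signed group elements. -/
def signedAction : W →* Function.End (W × ZMod 2) :=
  cs.lift ⟨cs.signedConj, cs.signedConj_isLiftable⟩

/-- The number, modulo two, of occurrences of `t` in the right inversion sequence of any word
for `w`. -/
def inversionParity (w t : W) : ZMod 2 := (cs.signedAction w (t, 0)).2

theorem signedAction_wordProd (ω : List B) (p : W × ZMod 2) :
    cs.signedAction (cs.wordProd ω) p =
      (cs.wordProd ω * p.1 * (cs.wordProd ω)⁻¹, p.2 + ((cs.rightInvSeq ω).count p.1 : ZMod 2)) := by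
  induction ω with
  | nil => simp [Function.End.one_def]
  | cons i ω ih =>
    rw [wordProd_cons, map_mul, Function.End.mul_apply, ih]
    have : cs.signedAction (cs.simple i) = cs.signedConj i := cs.lift_apply_simple _ i
    rw [this, signedConj, rightInvSeq, List.count_cons]
    refine Prod.ext ?_ ?_
    · simp [mul_assoc]
    · have : cs.wordProd ω * p.1 * (cs.wordProd ω)⁻¹ = cs.simple i ↔
          (cs.wordProd ω)⁻¹ * cs.simple i * cs.wordProd ω = p.1 := by
        constructor
        · intro h; rw [← h]; simp [mul_assoc]
        · intro h; rw [← h]; simp [mul_assoc]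
      simp [this, add_assoc]

theorem inversionParity_wordProd (ω : List B) (t : W) :
    cs.inversionParity (cs.wordProd ω) t = ((cs.rightInvSeq ω).count t : ZMod 2) := by
  simp [inversionParity, signedAction_wordProd]

theorem signedAction_apply (w : W) (p : W × ZMod 2) :
    cs.signedAction w p = (w * p.1 * w⁻¹, p.2 + cs.inversionParity w p.1) := by
  obtain ⟨ω, rfl⟩ := cs.wordProd_surjective w
  rw [inversionParity_wordProd, signedAction_wordProd]

theorem inversionParity_mul (w v t : W) :
    cs.inversionParity (w * v) t =
      cs.inversionParity v t + cs.inversionParity w (v * t * v⁻¹) := by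
  simp only [inversionParity, map_mul, Function.End.mul_apply]
  rw [cs.signedAction_apply v, cs.signedAction_apply w]
  simp [inversionParity]

@[simp] theorem inversionParity_one (t : W) : cs.inversionParity 1 t = 0 := by
  simp [inversionParity, Function.End.one_def]

theorem IsReflection.inversionParity_self {t : W} (ht : cs.IsReflection t) :
    cs.inversionParity t t = 1 := by
  obtain ⟨u, i, rfl⟩ := ht
  have h0 : cs.inversionParity (cs.simple i) (cs.simple i) = 1 := by
    simpa using cs.inversionParity_wordProd [i] (cs.simple i)
  have h1 := cs.inversionParity_mul u⁻¹ u (cs.simple i)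
  rw [inv_mul_cancel, inversionParity_one] at h1
  rw [inversionParity_mul, inversionParity_mul]
  simp only [mul_assoc, inv_mul_cancel_left, inv_inv, inv_mul_cancel, mul_one, one_mul, h0,
    simple_mul_simple_self, inv_simple] at h1 ⊢
  linear_combination -h1

theorem isRightInversion_of_inversionParity_eq_one {w t : W} (h : cs.inversionParity w t = 1) :
    cs.IsRightInversion w t := by
  obtain ⟨ω, hω, rfl⟩ := cs.exists_isReduced w
  refine cs.isRightInversion_of_mem_rightInvSeq hω ?_
  by_contra hm
  rw [inversionParity_wordProd, List.count_eq_zero_of_not_mem hm] at h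
  simp at h

theorem isRightInversion_iff_inversionParity {w t : W} (ht : cs.IsReflection t) :
    cs.IsRightInversion w t ↔ cs.inversionParity w t = 1 := by
  refine ⟨fun h => ?_, cs.isRightInversion_of_inversionParity_eq_one⟩
  by_contra hne
  have h0 : cs.inversionParity w t = 0 := by
    revert hne; generalize cs.inversionParity w t = x; revert x; decide
  have h1 : cs.inversionParity (w * t) t = 1 := by
    rw [inversionParity_mul, ht.inversionParity_self]; simp [h0]
  exact (ht.isRightInversion_mul_left_iff.mp (cs.isRightInversion_of_inversionParity_eq_one h1)) h

/-- Strong exchange property. -/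
theorem mem_rightInvSeq_of_isRightInversion {ω : List B} {t : W}
    (h : cs.IsRightInversion (cs.wordProd ω) t) : t ∈ cs.rightInvSeq ω := by
  have := (cs.isRightInversion_iff_inversionParity h.1).mp h
  by_contra hm
  rw [inversionParity_wordProd, List.count_eq_zero_of_not_mem hm] at this
  simp at this

/-- The cocycle property of right inversions. -/
theorem isRightInversion_mul_iff (w v : W) {t : W} (ht : cs.IsReflection t) :
    cs.IsRightInversion (w * v) t ↔
      Xor (cs.IsRightInversion v t) (cs.IsRightInversion w (v * t * v⁻¹)) := by
  rw [cs.isRightInversion_iff_inversionParity ht, cs.isRightInversion_iff_inversionParity ht,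
    cs.isRightInversion_iff_inversionParity (ht.conj v), inversionParity_mul]
  generalize cs.inversionParity v t = x
  generalize cs.inversionParity w (v * t * v⁻¹) = y
  revert x y
  unfold Xor
  decide

/-- Elements of a standard parabolic subgroup have reduced words in its generators. -/
theorem exists_isReduced_of_mem_closure {J : Set W} (hJ : J ⊆ Set.range cs.simple) {u : W}
    (hu : u ∈ Subgroup.closure J) :
    ∃ ω : List B, cs.IsReduced ω ∧ (∀ i ∈ ω, cs.simple i ∈ J) ∧ cs.wordProd ω = u := by
  have step : ∀ x, ∀ y ∈ J, (∃ ω : List B, cs.IsReduced ω ∧ (∀ i ∈ ω, cs.simple i ∈ J) ∧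
      cs.wordProd ω = x) → ∃ ω : List B, cs.IsReduced ω ∧ (∀ i ∈ ω, cs.simple i ∈ J) ∧
      cs.wordProd ω = x * y := by
    rintro x y hy ⟨ω, hω, hωJ, rfl⟩
    obtain ⟨i, rfl⟩ := hJ hy
    by_cases hd : cs.IsRightDescent (cs.wordProd ω) i
    · have hm := cs.mem_rightInvSeq_of_isRightInversion
        ((cs.isRightInversion_simple_iff_isRightDescent _ _).mpr hd)
      obtain ⟨k, hk, hki⟩ := List.mem_iff_getElem.mp hm
      have he : cs.wordProd ω * cs.simple i = cs.wordProd (ω.eraseIdx k) := by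
        rw [← hki, ← List.getD_eq_getElem _ 1 hk, wordProd_mul_getD_rightInvSeq]
      refine ⟨ω.eraseIdx k, ?_, fun j hj => hωJ j (List.mem_of_mem_eraseIdx hj), he.symm⟩
      have h1 := cs.isRightDescent_iff.mp hd
      rw [cs.length_rightInvSeq] at hk
      have h2 := List.length_eraseIdx_add_one hk
      have h3 := hω.eq
      rw [IsReduced, ← he]
      lia
    · refine ⟨ω ++ [i], ?_, ?_, by simp [wordProd_append]⟩
      · have h1 := cs.not_isRightDescent_iff.mp hd
        have h3 := hω.eq
        rw [IsReduced, wordProd_append, wordProd_singleton, List.length_append, h1, h3]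
        rfl
      · intro j hj
        rcases List.mem_append.mp hj with h | h
        · exact hωJ j h
        · rw [List.mem_singleton.mp h]; exact hy
  induction hu using Subgroup.closure_induction_right with
  | one => exact ⟨[], by simp [IsReduced], by simp, by simp⟩
  | mul_right x hx y hy ih => exact step x y hy ih
  | mul_inv_cancel x hx y hy ih =>
    obtain ⟨i, rfl⟩ := hJ hy
    rw [inv_simple]
    exact step x _ hy ih

end CoxeterSystem

namespace DPR

variable {B : Type} {W : Type} [Group W] [Fintype W] [DecidableEq W]
  {M : CoxeterMatrix B}

section Parabolic

variable (cs : CoxeterSystem M W)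

theorem mem_Simples {s : W} : s ∈ Simples cs ↔ ∃ i, cs.simple i = s := by
  simp [Simples]

theorem mem_minCoset {H : Set W} {J : Finset W} {w : W} :
    w ∈ minCoset cs H J ↔ w ∈ H ∧ ∀ s ∈ J, cs.length w < cs.length (w * s) := by
  simp [minCoset]

theorem mem_minCoset_univ {J : Finset W} {w : W} :
    w ∈ minCoset cs Set.univ J ↔ ∀ s ∈ J, cs.length w < cs.length (w * s) := by
  simp [minCoset]

variable {cs}

theorem coe_subset_range {J : Finset W} (hJ : J ⊆ Simples cs) :
    (J : Set W) ⊆ Set.range cs.simple := fun _ hs => (mem_Simples cs).mp (hJ hs)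

theorem mul_self_of_mem_Simples {s : W} (hs : s ∈ Simples cs) : s * s = 1 := by
  obtain ⟨i, rfl⟩ := (mem_Simples cs).mp hs
  simp

theorem isReflection_of_mem_Simples {s : W} (hs : s ∈ Simples cs) : cs.IsReflection s := by
  obtain ⟨i, rfl⟩ := (mem_Simples cs).mp hs
  exact cs.isReflection_simple i

theorem length_eq_one_of_mem_Simples {s : W} (hs : s ∈ Simples cs) : cs.length s = 1 := by
  obtain ⟨i, rfl⟩ := (mem_Simples cs).mp hs
  exact cs.length_simple i

theorem length_mul_eq_of_lt {w s : W} (hs : s ∈ Simples cs)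
    (h : cs.length w < cs.length (w * s)) : cs.length (w * s) = cs.length w + 1 := by
  have := cs.length_mul_le w s
  rw [length_eq_one_of_mem_Simples hs] at this
  lia

/-- `w` sends the positive root of the reflection `t` to a positive root. -/
theorem not_isRightInversion_iff {w t : W} (ht : cs.IsReflection t) :
    ¬ cs.IsRightInversion w t ↔ cs.length w < cs.length (w * t) := by
  have h1 := ht.length_mul_left_ne w
  simp only [CoxeterSystem.IsRightInversion, ht, true_and, not_lt]
  lia

/-- If `d` sends the positive root of `s` to a positive root, then `g * d` sends it to a
positive root exactly when `g` keeps the positive root of `d * s * d⁻¹` positive. -/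
theorem length_lt_length_mul_iff {g d s : W} (hs : cs.IsReflection s)
    (hd : cs.length d < cs.length (d * s)) :
    cs.length (g * d) < cs.length (g * d * s) ↔
      cs.length g < cs.length (g * (d * s * d⁻¹)) := by
  rw [← not_isRightInversion_iff hs, ← not_isRightInversion_iff (hs.conj d),
    cs.isRightInversion_mul_iff g d hs]
  have := (not_isRightInversion_iff hs).mpr hd
  simp [Xor, this]

theorem exists_mul_of_mem_closure {J : Finset W} (hJ : J ⊆ Simples cs) {u : W}
    (hu : u ∈ Subgroup.closure (J : Set W)) (h1 : u ≠ 1) :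
    ∃ v ∈ Subgroup.closure (J : Set W), ∃ s ∈ J, u = v * s ∧ cs.length u = cs.length v + 1 := by
  obtain ⟨ω, hω, hωJ, rfl⟩ := cs.exists_isReduced_of_mem_closure (coe_subset_range hJ) hu
  rcases List.eq_nil_or_concat ω with rfl | ⟨L, b, rfl⟩
  · simp at h1
  · have hb : cs.simple b ∈ J := hωJ b (by simp)
    have hL : cs.wordProd (L.concat b) = cs.wordProd L * cs.simple b := cs.wordProd_concat b L
    refine ⟨cs.wordProd L, ?_, cs.simple b, hb, hL, ?_⟩
    · have : cs.wordProd L = cs.wordProd (L.concat b) * (cs.simple b)⁻¹ := by rw [hL]; group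
      rw [this]
      exact mul_mem hu (inv_mem (Subgroup.subset_closure hb))
    · have h2 := hω.eq
      have h3 := cs.length_wordProd_le L
      have h4 := cs.length_mul_le (cs.wordProd L) (cs.simple b)
      rw [← hL, cs.length_simple] at h4
      simp only [List.length_concat] at h2
      lia

theorem mem_of_mem_closure_of_length_le {J : Finset W} (hJ : J ⊆ Simples cs) {u : W}
    (hu : u ∈ Subgroup.closure (J : Set W)) (h1 : u ≠ 1) (hl : cs.length u ≤ 1) : u ∈ J := by
  obtain ⟨v, -, s, hs, rfl, hv⟩ := exists_mul_of_mem_closure hJ hu h1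
  have : v = 1 := cs.length_eq_zero_iff.mp (by lia)
  simpa [this] using hs

theorem parabolic_induction {J : Finset W} (hJ : J ⊆ Simples cs) {p : W → Prop} (one : p 1)
    (mul : ∀ v ∈ Subgroup.closure (J : Set W), ∀ s ∈ J, cs.length v < cs.length (v * s) →
      p v → p (v * s)) {u : W} (hu : u ∈ Subgroup.closure (J : Set W)) : p u := by
  induction hn : cs.length u using Nat.strong_induction_on generalizing u with
  | _ n ih =>
    by_cases h1 : u = 1
    · rwa [h1]
    · obtain ⟨v, hv, s, hs, rfl, hl⟩ := exists_mul_of_mem_closure hJ hu h1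
      exact mul v hv s hs (by lia) (ih (cs.length v) (by lia) hv rfl)

theorem length_mul_of_forall_le {J : Finset W} (hJ : J ⊆ Simples cs) {m : W}
    (hm : ∀ u ∈ Subgroup.closure (J : Set W), cs.length m ≤ cs.length (m * u)) {u : W}
    (hu : u ∈ Subgroup.closure (J : Set W)) :
    cs.length (m * u) = cs.length m + cs.length u := by
  refine parabolic_induction (p := fun u => cs.length (m * u) = cs.length m + cs.length u)
    hJ (by simp) ?_ hu
  intro v hv s hs hlt ih
  have hs' := hJ hs
  have hr := isReflection_of_mem_Simples hs'
  have hconj : v * s * v⁻¹ ∈ Subgroup.closure (J : Set W) :=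
    mul_mem (mul_mem hv (Subgroup.subset_closure hs)) (inv_mem hv)
  have h1 : cs.length m < cs.length (m * (v * s * v⁻¹)) :=
    lt_of_le_of_ne (hm _ hconj) ((hr.conj v).length_mul_left_ne m).symm
  have h2 := (length_lt_length_mul_iff hr hlt).mpr h1
  rw [← mul_assoc, length_mul_eq_of_lt hs' h2, ih, length_mul_eq_of_lt hs' hlt, add_assoc]

theorem exists_forall_le (cs : CoxeterSystem M W) (J : Finset W) (w : W) :
    ∃ m, ∃ u ∈ Subgroup.closure (J : Set W), w = m * u ∧
      ∀ v ∈ Subgroup.closure (J : Set W), cs.length m ≤ cs.length (m * v) := by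
  let T : Finset W := Finset.univ.filter (fun v => v ∈ Subgroup.closure (J : Set W))
  obtain ⟨v, hv, hmin⟩ := T.exists_min_image (fun v => cs.length (w * v)) ⟨1, by simp [T, one_mem]⟩
  have hv' : v ∈ Subgroup.closure (J : Set W) := by simpa [T] using hv
  refine ⟨w * v, v⁻¹, inv_mem hv', by simp, fun u hu => ?_⟩
  rw [mul_assoc]
  exact hmin (v * u) (by simpa [T] using mul_mem hv' hu)

theorem minCoset_of_forall_le {J : Finset W} (hJ : J ⊆ Simples cs) {m : W}
    (hm : ∀ u ∈ Subgroup.closure (J : Set W), cs.length m ≤ cs.length (m * u)) :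
    m ∈ minCoset cs Set.univ J :=
  (mem_minCoset_univ cs).mpr fun s hs => lt_of_le_of_ne (hm s (Subgroup.subset_closure hs))
    ((isReflection_of_mem_Simples (hJ hs)).length_mul_left_ne m).symm

theorem exists_eq_mul (J : Finset W) (hJ : J ⊆ Simples cs) (w : W) :
    ∃ m ∈ minCoset cs Set.univ J, ∃ u ∈ Subgroup.closure (J : Set W), w = m * u := by
  obtain ⟨m, u, hu, rfl, hm⟩ := exists_forall_le cs J w
  exact ⟨m, minCoset_of_forall_le hJ hm, u, hu, rfl⟩

/-- Minimal coset representatives are length-additive. -/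
theorem length_mul_of_mem_minCoset {J : Finset W} (hJ : J ⊆ Simples cs) {w u : W}
    (hw : w ∈ minCoset cs Set.univ J) (hu : u ∈ Subgroup.closure (J : Set W)) :
    cs.length (w * u) = cs.length w + cs.length u := by
  obtain ⟨m, v, hv, rfl, hm⟩ := exists_forall_le cs J w
  have hv1 : v = 1 := by
    by_contra h1
    obtain ⟨v', hv', s, hs, rfl, hl⟩ := exists_mul_of_mem_closure hJ hv h1
    have h2 := (mem_minCoset_univ cs).mp hw s hs
    rw [mul_assoc, mul_assoc, mul_self_of_mem_Simples (hJ hs), mul_one,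
      length_mul_of_forall_le hJ hm hv', length_mul_of_forall_le hJ hm hv] at h2
    lia
  subst hv1
  rw [mul_one]
  exact length_mul_of_forall_le hJ hm hu

theorem minCoset_mul_injective {J : Finset W} (hJ : J ⊆ Simples cs) {w w' u u' : W}
    (hw : w ∈ minCoset cs Set.univ J) (hw' : w' ∈ minCoset cs Set.univ J)
    (hu : u ∈ Subgroup.closure (J : Set W)) (hu' : u' ∈ Subgroup.closure (J : Set W))
    (h : w * u = w' * u') : w = w' ∧ u = u' := by
  have e1 : w' = w * (u * u'⁻¹) := by rw [← mul_assoc, h]; simp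
  have e2 : w = w' * (u' * u⁻¹) := by rw [← mul_assoc, ← h]; simp
  have l1 := length_mul_of_mem_minCoset hJ hw (mul_mem hu (inv_mem hu'))
  have l2 := length_mul_of_mem_minCoset hJ hw' (mul_mem hu' (inv_mem hu))
  rw [← e1] at l1
  rw [← e2] at l2
  have : u * u'⁻¹ = 1 := cs.length_eq_zero_iff.mp (by lia)
  have huu : u = u' := mul_inv_eq_one.mp this
  subst huu
  exact ⟨mul_right_cancel h, rfl⟩

/-- Left-handed version of `length_mul_of_mem_minCoset`. -/
theorem length_mul_of_inv_mem_minCoset {J : Finset W} (hJ : J ⊆ Simples cs) {d u : W}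
    (hd : d⁻¹ ∈ minCoset cs Set.univ J) (hu : u ∈ Subgroup.closure (J : Set W)) :
    cs.length (u * d) = cs.length u + cs.length d := by
  have := length_mul_of_mem_minCoset hJ hd (inv_mem hu)
  rw [← mul_inv_rev, cs.length_inv, cs.length_inv, cs.length_inv] at this
  lia

/-- A coset representative sending a parabolic reflection to a simple one sees a simple one. -/
theorem mem_of_conj_mem_Simples {J : Finset W} (hJ : J ⊆ Simples cs) {w u : W}
    (hw : w ∈ minCoset cs Set.univ J) (hu : u ∈ Subgroup.closure (J : Set W))
    (h : w * u * w⁻¹ ∈ Simples cs) : u ∈ J := by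
  refine mem_of_mem_closure_of_length_le hJ hu ?_ ?_
  · rintro rfl
    have := length_eq_one_of_mem_Simples h
    simp at this
  · have h1 := length_mul_of_mem_minCoset hJ hw hu
    have h2 : w * u = (w * u * w⁻¹) * w := by group
    have h3 := cs.length_mul_le (w * u * w⁻¹) w
    rw [← h2, length_eq_one_of_mem_Simples h] at h3
    lia

end Parabolic

section Mackey

/-- Minimal double coset representatives, for `W_J` on the left and `W_K` on the right. -/
def doubleCosetReps (cs : CoxeterSystem M W) (J K : Finset W) : Finset W :=
  Finset.univ.filter (fun d => d ∈ minCoset cs Set.univ K ∧ d⁻¹ ∈ minCoset cs Set.univ J)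

/-- The part `K ∩ d⁻¹Jd` of `K` that is conjugated into `J` by `d`. -/
def conjInto (J K : Finset W) (d : W) : Finset W := K.filter (fun s => d * s * d⁻¹ ∈ J)

variable {cs : CoxeterSystem M W} {A : Type*} [AddCommMonoid A]

theorem mem_doubleCosetReps {J K : Finset W} {d : W} :
    d ∈ doubleCosetReps cs J K ↔
      d ∈ minCoset cs Set.univ K ∧ d⁻¹ ∈ minCoset cs Set.univ J := by
  simp [doubleCosetReps]

theorem mem_conjInto {J K : Finset W} {d s : W} :
    s ∈ conjInto J K d ↔ s ∈ K ∧ d * s * d⁻¹ ∈ J := by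
  simp [conjInto]

theorem conjInto_subset (J K : Finset W) (d : W) : conjInto J K d ⊆ K := filter_subset _ _

theorem mem_conjF {J : Finset W} {w t : W} : t ∈ conjF w J ↔ ∃ s ∈ J, w * s * w⁻¹ = t := by
  simp [conjF]

theorem conjF_conjInto_subset (J K : Finset W) (d : W) : conjF d (conjInto J K d) ⊆ J := by
  intro t ht
  obtain ⟨s, hs, rfl⟩ := mem_conjF.mp ht
  exact (mem_conjInto.mp hs).2

theorem mem_minCoset_conjF_iff {K : Finset W} (hK : K ⊆ Simples cs) {d : W}
    (hd : d ∈ minCoset cs Set.univ K) {g : W} :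
    g ∈ minCoset cs Set.univ (conjF d K) ↔ g * d ∈ minCoset cs Set.univ K := by
  rw [mem_minCoset_univ] at hd
  simp only [mem_minCoset_univ, conjF, forall_mem_image]
  exact forall₂_congr fun s hs =>
    (length_lt_length_mul_iff (isReflection_of_mem_Simples (hK hs)) (hd s hs)).symm

theorem sum_minCoset_conjF {K : Finset W} (hK : K ⊆ Simples cs) {d : W}
    (hd : d ∈ minCoset cs Set.univ K) (F : W → A) :
    ∑ g ∈ minCoset cs Set.univ (conjF d K), F (g * d) = ∑ g ∈ minCoset cs Set.univ K, F g := by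
  refine sum_nbij' (· * d) (· * d⁻¹) (fun g hg => (mem_minCoset_conjF_iff hK hd).mp hg)
    (fun g hg => (mem_minCoset_conjF_iff hK hd).mpr ?_) ?_ ?_ ?_ <;> simp_all

theorem sum_minCoset_mul {J N : Finset W} (hJ : J ⊆ Simples cs) (hN : N ⊆ J) (F : W → A) :
    ∑ w ∈ minCoset cs Set.univ J,
        ∑ a ∈ minCoset cs (Subgroup.closure (J : Set W) : Set W) N, F (w * a) =
      ∑ g ∈ minCoset cs Set.univ N, F g := by
  have key : ∀ w ∈ minCoset cs Set.univ J, ∀ a ∈ Subgroup.closure (J : Set W),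
      (w * a ∈ minCoset cs Set.univ N ↔ ∀ s ∈ N, cs.length a < cs.length (a * s)) := by
    intro w hw a ha
    rw [mem_minCoset_univ]
    refine forall₂_congr fun s hs => ?_
    rw [mul_assoc, length_mul_of_mem_minCoset hJ hw ha, length_mul_of_mem_minCoset hJ hw
      (mul_mem ha (Subgroup.subset_closure (hN hs)))]
    simp
  rw [← sum_product']
  refine sum_bij (fun x _ => x.1 * x.2) ?_ ?_ ?_ (fun _ _ => rfl)
  · rintro ⟨w, a⟩ hx
    obtain ⟨hw, ha⟩ := mem_product.mp hx
    obtain ⟨ha, hs⟩ := (mem_minCoset cs).mp ha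
    exact (key w hw a ha).mpr hs
  · rintro ⟨w, a⟩ hx ⟨w', a'⟩ hx' h
    obtain ⟨hw, ha⟩ := mem_product.mp hx
    obtain ⟨hw', ha'⟩ := mem_product.mp hx'
    obtain ⟨h1, h2⟩ := minCoset_mul_injective hJ hw hw' ((mem_minCoset cs).mp ha).1
      ((mem_minCoset cs).mp ha').1 h
    exact Prod.ext h1 h2
  · intro g hg
    obtain ⟨w, hw, a, ha, rfl⟩ := exists_eq_mul J hJ g
    exact ⟨(w, a), mem_product.mpr ⟨hw, (mem_minCoset cs).mpr ⟨ha, (key w hw a ha).mp hg⟩⟩, rfl⟩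

/-- Deodhar's lemma: a minimal right coset representative multiplied by a simple reflection
either stays minimal or moves within its coset. -/
theorem inv_mul_mem_minCoset {J : Finset W} (hJ : J ⊆ Simples cs) {d s : W}
    (hs : s ∈ Simples cs) (hd : d⁻¹ ∈ minCoset cs Set.univ J) (hds : d * s * d⁻¹ ∉ J) :
    (d * s)⁻¹ ∈ minCoset cs Set.univ J := by
  rw [mem_minCoset_univ] at hd ⊢
  intro t ht
  have hr := isReflection_of_mem_Simples (hJ ht)
  rw [mul_inv_rev, length_lt_length_mul_iff hr (hd t ht), (isReflection_of_mem_Simples hs).inv]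
  by_contra hlt
  have hne := (hr.conj d⁻¹).length_mul_left_ne s
  rw [length_eq_one_of_mem_Simples hs] at hlt hne
  have h1 : s * (d⁻¹ * t * d⁻¹⁻¹) = 1 := cs.length_eq_zero_iff.mp (by lia)
  apply hds
  have h2 : s = d⁻¹ * t * d := by
    have := eq_inv_of_mul_eq_one_left h1
    rw [(hr.conj d⁻¹).inv] at this
    simpa using this
  rw [h2]
  simpa [mul_assoc] using ht

theorem mul_mem_minCoset_iff {J K : Finset W} (hJ : J ⊆ Simples cs) (hK : K ⊆ Simples cs)
    {d a : W} (hd : d ∈ doubleCosetReps cs J K) (ha : a ∈ Subgroup.closure (J : Set W)) :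
    a * d ∈ minCoset cs Set.univ K ↔ a ∈ minCoset cs Set.univ (conjF d (conjInto J K d)) := by
  obtain ⟨hdK, hdJ⟩ := mem_doubleCosetReps.mp hd
  rw [mem_minCoset_univ] at hdK
  simp only [mem_minCoset_univ, conjF, forall_mem_image]
  constructor
  · intro h s hs
    have hsK := (mem_conjInto.mp hs).1
    exact (length_lt_length_mul_iff (isReflection_of_mem_Simples (hK hsK)) (hdK s hsK)).mp
      (h s hsK)
  · intro h s hs
    by_cases hsJ : d * s * d⁻¹ ∈ J
    · exact (length_lt_length_mul_iff (isReflection_of_mem_Simples (hK hs)) (hdK s hs)).mpr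
        (h (mem_conjInto.mpr ⟨hs, hsJ⟩))
    · have h1 := inv_mul_mem_minCoset hJ (hK hs) hdJ hsJ
      rw [mul_assoc, length_mul_of_inv_mem_minCoset hJ h1 ha,
        length_mul_of_inv_mem_minCoset hJ hdJ ha]
      have := hdK s hs
      lia

theorem sum_minCoset_doubleCosetReps {J K : Finset W} (hJ : J ⊆ Simples cs)
    (hK : K ⊆ Simples cs) (F : W → A) :
    ∑ d ∈ doubleCosetReps cs J K,
        ∑ a ∈ minCoset cs (Subgroup.closure (J : Set W) : Set W) (conjF d (conjInto J K d)),
          F (a * d) =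
      ∑ d ∈ minCoset cs Set.univ K, F d := by
  rw [sum_sigma']
  refine sum_bij (fun x _ => x.2 * x.1) ?_ ?_ ?_ (fun _ _ => rfl)
  · rintro ⟨d, a⟩ hx
    obtain ⟨hd, ha⟩ := mem_sigma.mp hx
    obtain ⟨ha, hs⟩ := (mem_minCoset cs).mp ha
    exact (mul_mem_minCoset_iff hJ hK hd ha).mpr ((mem_minCoset_univ cs).mpr hs)
  · rintro ⟨d, a⟩ hx ⟨d', a'⟩ hx' h
    obtain ⟨hd, ha⟩ := mem_sigma.mp hx
    obtain ⟨hd', ha'⟩ := mem_sigma.mp hx'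
    have h' : d⁻¹ * a⁻¹ = d'⁻¹ * a'⁻¹ := by
      rw [← mul_inv_rev, ← mul_inv_rev]; exact congrArg _ h
    obtain ⟨h1, h2⟩ := minCoset_mul_injective hJ (mem_doubleCosetReps.mp hd).2
      (mem_doubleCosetReps.mp hd').2 (inv_mem ((mem_minCoset cs).mp ha).1)
      (inv_mem ((mem_minCoset cs).mp ha').1) h'
    rw [inv_inj] at h1 h2
    simp only at h1 h2
    subst h1 h2
    rfl
  · intro g hg
    obtain ⟨m, hm, u, hu, hgm⟩ := exists_eq_mul J hJ g⁻¹
    have hg' : g = u⁻¹ * m⁻¹ := by rw [← mul_inv_rev, ← hgm, inv_inv]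
    have hm' : m⁻¹⁻¹ ∈ minCoset cs Set.univ J := by rwa [inv_inv]
    have hd : m⁻¹ ∈ doubleCosetReps cs J K := by
      refine mem_doubleCosetReps.mpr ⟨(mem_minCoset_univ cs).mpr fun s hs => ?_, hm'⟩
      by_contra hlt
      have h1 := (mem_minCoset_univ cs).mp hg s hs
      have h2 := length_mul_of_inv_mem_minCoset hJ hm' (inv_mem hu)
      have h3 := cs.length_mul_le u⁻¹ (m⁻¹ * s)
      rw [← mul_assoc, ← hg'] at h3
      rw [← hg'] at h2
      lia
    refine ⟨⟨m⁻¹, u⁻¹⟩, mem_sigma.mpr ⟨hd, (mem_minCoset cs).mpr ⟨inv_mem hu, ?_⟩⟩, hg'.symm⟩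
    rw [hg'] at hg
    exact (mem_minCoset_univ cs).mp ((mul_mem_minCoset_iff hJ hK hd (inv_mem hu)).mp hg)

theorem mem_minCoset_mono {H : Set W} {J K : Finset W} (hJK : J ⊆ K) {w : W}
    (hw : w ∈ minCoset cs H K) : w ∈ minCoset cs H J :=
  (mem_minCoset cs).mpr ⟨((mem_minCoset cs).mp hw).1,
    fun s hs => ((mem_minCoset cs).mp hw).2 s (hJK hs)⟩

/-- The Mackey decomposition of a product of two coset sums. -/
theorem sum_mackey {J K : Finset W} (hJ : J ⊆ Simples cs) (hK : K ⊆ Simples cs) (F : W → A)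
    {d : W} (hd : d ∈ doubleCosetReps cs J K) :
    ∑ w ∈ minCoset cs Set.univ J,
        ∑ a ∈ minCoset cs (Subgroup.closure (J : Set W) : Set W) (conjF d (conjInto J K d)),
          F (w * a * d) =
      ∑ g ∈ minCoset cs Set.univ (conjInto J K d), F g := by
  rw [sum_minCoset_mul hJ (conjF_conjInto_subset J K d) (fun g => F (g * d))]
  exact sum_minCoset_conjF ((conjInto_subset J K d).trans hK)
    (mem_minCoset_mono (conjInto_subset J K d) (mem_doubleCosetReps.mp hd).1) F

theorem xRel_mul_xRel {J K : Finset W} (hJ : J ⊆ Simples cs) (hK : K ⊆ Simples cs) :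
    xRel cs Set.univ J * xRel cs Set.univ K =
      ∑ d ∈ doubleCosetReps cs J K, xRel cs Set.univ (conjInto J K d) := by
  simp only [xRel]
  rw [← sum_minCoset_doubleCosetReps hJ hK, mul_sum]
  refine sum_congr rfl fun d hd => ?_
  rw [← sum_mackey hJ hK (fun g => of ℂ W g) hd, sum_mul_sum]
  simp only [map_mul, mul_assoc]

end Mackey

section QuasiIdempotents

variable {cs : CoxeterSystem M W}

theorem conjF_conjF (w d : W) (L : Finset W) : conjF w (conjF d L) = conjF (w * d) L := by
  ext t
  simp [mem_conjF, mul_assoc]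

theorem conjF_one (L : Finset W) : conjF 1 L = L := by simp [conjF]

theorem conjF_injective (d : W) : Function.Injective (conjF d : Finset W → Finset W) :=
  Finset.image_injective fun a b h => by simpa using h

theorem card_conjF (d : W) (L : Finset W) : (conjF d L).card = L.card :=
  card_image_of_injective _ fun a b h => by simpa using h

theorem conjF_subset_iff {J L : Finset W} {d : W} :
    conjF d L ⊆ J ↔ ∀ s ∈ L, d * s * d⁻¹ ∈ J := by
  simp [conjF, image_subset_iff]

theorem Takes.conjF_subset {D L : Finset W} {d : W} (h : Takes cs D d L) : conjF d L ⊆ D :=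
  conjF_subset_iff.mpr fun s hs => (h s hs).1

theorem Takes.mem_minCoset {D L : Finset W} {d : W} (h : Takes cs D d L) :
    d ∈ minCoset cs Set.univ L :=
  (mem_minCoset_univ cs).mpr fun s hs => by rw [(h s hs).2]; exact Nat.lt_succ_self _

theorem takes_of_conjF_subset {L : Finset W} {d : W} (hL : L ⊆ Simples cs)
    (hd : d ∈ minCoset cs Set.univ L) (h : conjF d L ⊆ Simples cs) :
    Takes cs (Simples cs) d L := fun s hs =>
  ⟨conjF_subset_iff.mp h s hs,
    length_mul_eq_of_lt (hL hs) ((mem_minCoset_univ cs).mp hd s hs)⟩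

theorem takes_conjF_iff {L : Finset W} {w d : W} (hL : L ⊆ Simples cs)
    (hd : Takes cs (Simples cs) d L) :
    Takes cs (Simples cs) w (conjF d L) ↔ Takes cs (Simples cs) (w * d) L := by
  simp only [Takes, conjF, forall_mem_image]
  refine forall₂_congr fun s hs => and_congr ?_ ?_
  · simp [mul_assoc]
  · have h1 := length_lt_length_mul_iff (g := w) (d := d)
      (isReflection_of_mem_Simples (hL hs))
      (by rw [(hd s hs).2]; exact Nat.lt_succ_self _)
    constructor
    · intro h
      exact length_mul_eq_of_lt (hL hs) (h1.mpr (by lia))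
    · intro h
      exact length_mul_eq_of_lt (hd s hs).1 (h1.mp (by lia))

theorem mC_of_subset {σ : Finset W → ℝ} {L K : Finset W} (h : L ⊆ K) :
    mC cs Set.univ (Simples cs) σ L K =
      ∑ w ∈ minCoset cs Set.univ K,
        if Takes cs (Simples cs) w L then σ (conjF w L) else 0 := by
  rw [mC, if_pos h, sum_filter]

theorem mC_of_not_subset {σ : Finset W → ℝ} {L K : Finset W} (h : ¬ L ⊆ K) :
    mC cs Set.univ (Simples cs) σ L K = 0 := by
  rw [mC, if_neg h]

theorem takes_one {J : Finset W} (hJ : J ⊆ Simples cs) : Takes cs (Simples cs) 1 J :=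
  fun s hs => by simpa using ⟨hJ hs, length_eq_one_of_mem_Simples (hJ hs)⟩

theorem mC_self_pos {σ : Finset W → ℝ} (hσ : PosOn (Simples cs) σ) {J : Finset W}
    (hJ : J ⊆ Simples cs) : 0 < mC cs Set.univ (Simples cs) σ J J := by
  rw [mC, if_pos Subset.rfl]
  refine sum_pos (fun w hw => hσ _ (mem_powerset.mpr (mem_filter.mp hw).2.conjF_subset)) ⟨1, ?_⟩
  exact mem_filter.mpr ⟨(takes_one hJ).mem_minCoset, takes_one hJ⟩

theorem mC_conjF {σ : Finset W → ℝ} {L K : Finset W} (hK : K ⊆ Simples cs) (hLK : L ⊆ K) {d : W}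
    (hd : Takes cs (Simples cs) d K) :
    mC cs Set.univ (Simples cs) σ (conjF d L) (conjF d K) =
      mC cs Set.univ (Simples cs) σ L K := by
  have hdL : Takes cs (Simples cs) d L := fun s hs => hd s (hLK hs)
  have hsub : conjF d L ⊆ conjF d K := image_subset_image hLK
  rw [mC_of_subset hLK, mC_of_subset hsub,
    ← sum_minCoset_conjF hK hd.mem_minCoset]
  simp only [takes_conjF_iff (hLK.trans hK) hdL, conjF_conjF]

theorem sum_mC_conjF (σ : Finset W → ℝ) {J K L : Finset W} (hJ : J ⊆ Simples cs)
    (hK : K ⊆ Simples cs) (hL : L ⊆ K) :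
    ∑ d ∈ (minCoset cs Set.univ K).filter
        (fun d => Takes cs (Simples cs) d L ∧ conjF d L ⊆ J),
        mC cs Set.univ (Simples cs) σ (conjF d L) J =
      ∑ d ∈ doubleCosetReps cs J K, mC cs Set.univ (Simples cs) σ L (conjInto J K d) := by
  have hLS := hL.trans hK
  let f : W → ℝ := fun g => if Takes cs (Simples cs) g L then σ (conjF g L) else 0
  have h1 : ∀ d ∈ minCoset cs Set.univ K,
      (if Takes cs (Simples cs) d L ∧ conjF d L ⊆ J then
        mC cs Set.univ (Simples cs) σ (conjF d L) J else 0) =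
      ∑ w ∈ minCoset cs Set.univ J, if conjF d L ⊆ J then f (w * d) else 0 := by
    intro d hd
    by_cases hdJ : conjF d L ⊆ J
    · have ht := takes_of_conjF_subset hLS (mem_minCoset_mono hL hd) (hdJ.trans hJ)
      rw [if_pos ⟨ht, hdJ⟩, mC_of_subset hdJ]
      simp only [hdJ, if_true, f, takes_conjF_iff hLS ht, conjF_conjF]
    · simp [hdJ]
  rw [sum_filter, sum_congr rfl h1, ← sum_minCoset_doubleCosetReps hJ hK]
  refine sum_congr rfl fun d hd => ?_
  have hdJ := (mem_doubleCosetReps.mp hd).2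
  have h2 : ∀ w ∈ minCoset cs Set.univ J,
      ∀ a ∈ minCoset cs (Subgroup.closure (J : Set W) : Set W) (conjF d (conjInto J K d)),
      (if conjF (a * d) L ⊆ J then f (w * (a * d)) else 0) =
        if L ⊆ conjInto J K d then f (w * a * d) else 0 := by
    intro w hw a ha
    have ha' := ((mem_minCoset cs).mp ha).1
    rw [← mul_assoc]
    by_cases ht : Takes cs (Simples cs) (w * a * d) L
    · refine if_congr ?_ rfl rfl
      rw [conjF_subset_iff]
      constructor
      · intro h s hs
        refine mem_conjInto.mpr ⟨hL hs, ?_⟩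
        refine mem_of_conj_mem_Simples hJ hdJ ?_ ?_
        · have := mul_mem (mul_mem (inv_mem ha') (Subgroup.subset_closure (h s hs))) ha'
          simpa [mul_assoc] using this
        · simpa [mul_assoc] using hLS hs
      · intro h s hs
        refine mem_of_conj_mem_Simples hJ hw ?_ ?_
        · have := mul_mem (mul_mem ha'
            (Subgroup.subset_closure (mem_conjInto.mp (h hs)).2)) (inv_mem ha')
          simpa [mul_assoc] using this
        · simpa [mul_assoc] using (ht s hs).1
    · simp [f, ht]
  rw [sum_comm, sum_congr rfl fun w hw => sum_congr rfl (h2 w hw)]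
  by_cases hLd : L ⊆ conjInto J K d
  · simp only [hLd, if_true]
    rw [sum_mackey hJ hK f hd, mC_of_subset hLd]
  · simp [hLd, mC_of_not_subset hLd]

variable {σ : Finset W → ℝ} {e : Finset W → MonoidAlgebra ℂ W}

/-- Conjugate quasi-idempotents differ by a group element on the right. -/
theorem e_conjF_mul_of (hσ : PosOn (Simples cs) σ) (he : IsBBHT cs Set.univ (Simples cs) σ e)
    {d : W} (K : Finset W) (hK : K ⊆ Simples cs) (hd : Takes cs (Simples cs) d K) :
    e (conjF d K) * of ℂ W d = e K := by
  induction K using Finset.strongInduction with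
  | H K ih =>
    have h1 : xRel cs Set.univ (conjF d K) * of ℂ W d = xRel cs Set.univ K := by
      simp only [xRel, sum_mul, ← map_mul]
      exact sum_minCoset_conjF hK hd.mem_minCoset (fun g => of ℂ W g)
    have h2 : xRel cs Set.univ (conjF d K) * of ℂ W d =
        ∑ L ∈ K.powerset,
          (mC cs Set.univ (Simples cs) σ L K : ℂ) • (e (conjF d L) * of ℂ W d) := by
      rw [he _ (mem_powerset.mpr hd.conjF_subset), sum_mul]
      symm
      refine sum_bij (fun L _ => conjF d L) ?_ (fun _ _ _ _ h => conjF_injective d h) ?_ ?_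
      · intro L hL
        exact mem_powerset.mpr (image_subset_image (mem_powerset.mp hL))
      · intro L hL
        obtain ⟨L', hL', rfl⟩ := subset_image_iff.mp (mem_powerset.mp hL)
        exact ⟨L', mem_powerset.mpr (by exact_mod_cast hL'), rfl⟩
      · intro L hL
        rw [mC_conjF hK (mem_powerset.mp hL) hd, smul_mul_assoc]
    rw [h1, he K (mem_powerset.mpr hK), ← sub_eq_zero, ← sum_sub_distrib,
      sum_eq_single K] at h2
    · rw [← smul_sub, smul_eq_zero, sub_eq_zero] at h2
      exact (h2.resolve_left (by exact_mod_cast (mC_self_pos hσ hK).ne')).symm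
    · intro L hL hne
      have hLK := mem_powerset.mp hL
      rw [ih L (hLK.ssubset_of_ne hne) (hLK.trans hK) fun s hs => hd s (hLK hs), sub_self]
    · intro h
      exact absurd (mem_powerset_self K) h

theorem e_mul_xRel (hσ : PosOn (Simples cs) σ) (he : IsBBHT cs Set.univ (Simples cs) σ e)
    {K : Finset W} (hK : K ⊆ Simples cs) (J : Finset W) (hJ : J ⊆ Simples cs) :
    e J * xRel cs Set.univ K =
      ∑ L ∈ K.powerset, ∑ _d ∈ (minCoset cs Set.univ K).filter
        (fun d => Takes cs (Simples cs) d L ∧ conjF d L = J), e L := by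
  induction J using Finset.strongInduction with
  | H J ih =>
    have h1 : xRel cs Set.univ J * xRel cs Set.univ K = ∑ L₀ ∈ J.powerset,
        (mC cs Set.univ (Simples cs) σ L₀ J : ℂ) • (e L₀ * xRel cs Set.univ K) := by
      rw [he J (mem_powerset.mpr hJ), sum_mul]
      simp only [smul_mul_assoc]
    have h2 : xRel cs Set.univ J * xRel cs Set.univ K = ∑ L₀ ∈ J.powerset,
        (mC cs Set.univ (Simples cs) σ L₀ J : ℂ) •
          ∑ L ∈ K.powerset, ∑ _d ∈ (minCoset cs Set.univ K).filter
            (fun d => Takes cs (Simples cs) d L ∧ conjF d L = L₀), e L := by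
      have hx : ∀ d ∈ doubleCosetReps cs J K, xRel cs Set.univ (conjInto J K d) =
          ∑ L ∈ K.powerset,
            (mC cs Set.univ (Simples cs) σ L (conjInto J K d) : ℂ) • e L := by
        intro d _
        rw [he _ (mem_powerset.mpr ((conjInto_subset J K d).trans hK))]
        refine sum_subset (powerset_mono.mpr (conjInto_subset J K d)) fun L _ hL => ?_
        rw [mC_of_not_subset (by simpa using hL)]
        simp
      rw [xRel_mul_xRel hJ hK, sum_congr rfl hx, sum_comm]
      simp only [smul_sum]
      rw [sum_comm (s := J.powerset)]
      refine sum_congr rfl fun L hL => ?_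
      have hmaps : ∀ d ∈ (minCoset cs Set.univ K).filter
          (fun d => Takes cs (Simples cs) d L ∧ conjF d L ⊆ J), conjF d L ∈ J.powerset :=
        fun d hd => mem_powerset.mpr (mem_filter.mp hd).2.2
      rw [← sum_smul, ← Complex.ofReal_sum, ← sum_mC_conjF σ hJ hK (mem_powerset.mp hL),
        Complex.ofReal_sum, sum_smul, ← sum_fiberwise_of_maps_to hmaps]
      refine sum_congr rfl fun L₀ hL₀ => ?_
      rw [filter_filter]
      refine sum_congr (filter_congr fun d _ => ?_) fun d hd => ?_
      · constructor
        · rintro ⟨⟨h, -⟩, h'⟩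
          exact ⟨h, h'⟩
        · rintro ⟨h, h'⟩
          exact ⟨⟨h, h' ▸ mem_powerset.mp hL₀⟩, h'⟩
      · rw [(mem_filter.mp hd).2.2]
    rw [h1, ← sub_eq_zero, ← sum_sub_distrib, sum_eq_single J] at h2
    · rw [← smul_sub, smul_eq_zero, sub_eq_zero] at h2
      exact h2.resolve_left (by exact_mod_cast (mC_self_pos hσ hJ).ne')
    · intro L hL hne
      have hLJ := mem_powerset.mp hL
      rw [ih L (hLJ.ssubset_of_ne hne) (hLJ.trans hJ), sub_self]
    · intro h
      exact absurd (mem_powerset_self J) h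

theorem e_mul_xRel_of_card_le (hσ : PosOn (Simples cs) σ)
    (he : IsBBHT cs Set.univ (Simples cs) σ e) {J K : Finset W} (hJ : J ⊆ Simples cs)
    (hK : K ⊆ Simples cs) (hcard : K.card ≤ J.card) :
    e J * xRel cs Set.univ K =
      (((minCoset cs Set.univ K).filter
        (fun d => Takes cs (Simples cs) d K ∧ conjF d K = J)).card : ℂ) • e K := by
  rw [e_mul_xRel hσ he hK J hJ, sum_eq_single K]
  · rw [sum_const, Nat.cast_smul_eq_nsmul]
  · intro L hL hne
    rw [filter_eq_empty_iff.mpr, sum_empty]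
    rintro d - ⟨-, rfl⟩
    rw [card_conjF] at hcard
    exact hne (eq_of_subset_of_card_le (mem_powerset.mp hL) hcard)
  · intro h
    exact absurd (mem_powerset_self K) h

theorem e_mul_e_of_card_lt (hσ : PosOn (Simples cs) σ)
    (he : IsBBHT cs Set.univ (Simples cs) σ e) {J : Finset W} (hJ : J ⊆ Simples cs)
    (K : Finset W) (hK : K ⊆ Simples cs) (hcard : K.card < J.card) : e J * e K = 0 := by
  induction K using Finset.strongInduction with
  | H K ih =>
    have h := e_mul_xRel_of_card_le hσ he hJ hK hcard.le
    rw [filter_eq_empty_iff.mpr, card_empty, Nat.cast_zero, zero_smul,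
      he K (mem_powerset.mpr hK), mul_sum, sum_eq_single K] at h
    · rw [mul_smul_comm, smul_eq_zero] at h
      exact h.resolve_left (by exact_mod_cast (mC_self_pos hσ hK).ne')
    · intro L hL hne
      have hLK := mem_powerset.mp hL
      rw [mul_smul_comm, ih L (hLK.ssubset_of_ne hne) (hLK.trans hK)
        ((card_le_card hLK).trans_lt hcard), smul_zero]
    · intro h
      exact absurd (mem_powerset_self K) h
    · rintro d - ⟨-, rfl⟩
      rw [card_conjF] at hcard
      exact lt_irrefl _ hcard

theorem smul_e_mul_e_of_card_eq (hσ : PosOn (Simples cs) σ)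
    (he : IsBBHT cs Set.univ (Simples cs) σ e) {J K : Finset W} (hJ : J ⊆ Simples cs)
    (hK : K ⊆ Simples cs) (hcard : K.card = J.card) :
    (mC cs Set.univ (Simples cs) σ K K : ℂ) • (e J * e K) =
      (((minCoset cs Set.univ K).filter
        (fun d => Takes cs (Simples cs) d K ∧ conjF d K = J)).card : ℂ) • e K := by
  rw [← e_mul_xRel_of_card_le hσ he hJ hK hcard.le, he K (mem_powerset.mpr hK), mul_sum,
    sum_eq_single K, mul_smul_comm]
  · intro L hL hne
    have hLK := mem_powerset.mp hL
    rw [mul_smul_comm, e_mul_e_of_card_lt hσ he hJ L (hLK.trans hK)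
      ((card_lt_card (hLK.ssubset_of_ne hne)).trans_eq hcard), smul_zero]
  · intro h
    exact absurd (mem_powerset_self K) h

theorem ShapeEq.refl (I : Finset W) : ShapeEq I I := ⟨1, by ext; simp⟩

/-- Subsets of the same shape are conjugate by an element taking simple roots to simple roots. -/
theorem ShapeEq.exists_takes {I J : Finset W} (hI : I ⊆ Simples cs) (hJ : J ⊆ Simples cs)
    (h : ShapeEq I J) : ∃ d, Takes cs (Simples cs) d I ∧ conjF d I = J := by
  obtain ⟨w, hw⟩ := h
  obtain ⟨m, hm, u, hu, rfl⟩ := exists_eq_mul I hI w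
  have mem_iff : ∀ x : W, x ∈ Subgroup.closure (J : Set W) ↔
      m⁻¹ * x * m ∈ Subgroup.closure (I : Set W) := by
    intro x
    rw [hw, Subgroup.mem_map]
    constructor
    · rintro ⟨y, hy, rfl⟩
      have := mul_mem (mul_mem hu hy) (inv_mem hu)
      simpa [mul_assoc] using this
    · intro hx
      refine ⟨u⁻¹ * (m⁻¹ * x * m) * u, mul_mem (mul_mem (inv_mem hu) hx) hu, ?_⟩
      simp [mul_assoc]
  have hmJ : m⁻¹ ∈ minCoset cs Set.univ J := by
    refine (mem_minCoset_univ cs).mpr fun t ht => ?_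
    have hr := isReflection_of_mem_Simples (hJ ht)
    have h1 := length_mul_of_mem_minCoset hI hm ((mem_iff t).mp (Subgroup.subset_closure ht))
    have h2 : m * (m⁻¹ * t * m) = (m⁻¹ * t)⁻¹ := by
      rw [mul_inv_rev, hr.inv]; simp [mul_assoc]
    rw [h2, cs.length_inv] at h1
    have h3 := hr.length_mul_left_ne m⁻¹
    rw [cs.length_inv] at h3 ⊢
    lia
  have hsub : conjF m I ⊆ J := conjF_subset_iff.mpr fun s hs =>
    mem_of_conj_mem_Simples hJ hmJ
      ((mem_iff _).mpr (by simpa [mul_assoc] using Subgroup.subset_closure hs))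
      (by simpa [mul_assoc] using hI hs)
  refine ⟨m, takes_of_conjF_subset hI hm (hsub.trans hJ), hsub.antisymm fun t ht => ?_⟩
  refine mem_conjF.mpr ⟨m⁻¹ * t * m, ?_, by group⟩
  exact mem_of_conj_mem_Simples hI hm ((mem_iff t).mp (Subgroup.subset_closure ht))
    (by simpa [mul_assoc] using hJ ht)

/-- Up to a positive scalar, the shape idempotent fixes each of its quasi-idempotents. -/
theorem exists_smul_eq_sum_mul (hσ : PosOn (Simples cs) σ)
    (he : IsBBHT cs Set.univ (Simples cs) σ e) {I : Finset W} (hI : I ⊆ Simples cs) :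
    ∃ r : ℝ, 0 < r ∧ (r : ℂ) • e I = (mC cs Set.univ (Simples cs) σ I I : ℂ) •
      ((∑ J ∈ (Simples cs).powerset.filter (fun J => ShapeEq I J), (σ J : ℂ) • e J) * e I) := by
  refine ⟨∑ J ∈ (Simples cs).powerset.filter (fun J => ShapeEq I J), σ J *
    (((minCoset cs Set.univ I).filter
        (fun d => Takes cs (Simples cs) d I ∧ conjF d I = J)).card : ℝ), ?_, ?_⟩
  · refine sum_pos' (fun J hJ => mul_nonneg (hσ J (mem_filter.mp hJ).1).le (Nat.cast_nonneg _))
      ⟨I, mem_filter.mpr ⟨mem_powerset.mpr hI, ShapeEq.refl I⟩, ?_⟩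
    refine mul_pos (hσ I (mem_powerset.mpr hI)) (Nat.cast_pos.mpr (card_pos.mpr ⟨1, ?_⟩))
    exact mem_filter.mpr ⟨(takes_one hI).mem_minCoset, takes_one hI, conjF_one I⟩
  · rw [Complex.ofReal_sum, sum_smul, sum_mul, smul_sum]
    refine sum_congr rfl fun J hJ => ?_
    obtain ⟨hJS, hIJ⟩ := mem_filter.mp hJ
    obtain ⟨d, -, rfl⟩ := hIJ.exists_takes hI (mem_powerset.mp hJS)
    rw [smul_mul_assoc, smul_comm,
      smul_e_mul_e_of_card_eq hσ he (mem_powerset.mp hJS) hI (card_conjF d I).symm, smul_smul]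
    push_cast
    rfl

end QuasiIdempotents

/-- Lemma 4.1: for a shape `λ` of `W` and `I ∈ S_λ`, the right ideal
`E^σ_λ = e^σ_λ ℂW` equals the right ideal `e^σ_I ℂW`, where
`e^σ_λ = ∑_{J ∈ S_λ} σ(J) e^σ_J` and `S_λ` is the shape of `I` (the set of
subsets `J ⊆ S` with `W_J` conjugate to `W_I`). -/
theorem stmt6 (cs : CoxeterSystem M W) (σ : Finset W → ℝ) (hσ : PosOn (Simples cs) σ)
    (e : Finset W → MonoidAlgebra ℂ W) (he : IsBBHT cs Set.univ (Simples cs) σ e)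
    (I : Finset W) (hI : I ⊆ Simples cs) :
    Set.range (fun y : MonoidAlgebra ℂ W =>
        (∑ J ∈ (Simples cs).powerset.filter (fun J => ShapeEq I J), (σ J : ℂ) • e J) * y)
      = Set.range (fun y : MonoidAlgebra ℂ W => e I * y) := by
  have hex : ∀ J ∈ (Simples cs).powerset.filter (fun J => ShapeEq I J),
      ∃ z : MonoidAlgebra ℂ W, e J = e I * z := by
    intro J hJ
    obtain ⟨hJS, hIJ⟩ := mem_filter.mp hJ
    obtain ⟨d, hd, rfl⟩ := hIJ.exists_takes hI (mem_powerset.mp hJS)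
    refine ⟨of ℂ W d⁻¹, ?_⟩
    rw [← e_conjF_mul_of hσ he I hI hd, mul_assoc, ← map_mul, mul_inv_cancel, map_one, mul_one]
  choose! z hz using hex
  obtain ⟨r, hr, hrI⟩ := exists_smul_eq_sum_mul hσ he hI
  refine Set.Subset.antisymm ?_ ?_
  · rintro _ ⟨y, rfl⟩
    refine ⟨(∑ J ∈ (Simples cs).powerset.filter (fun J => ShapeEq I J), (σ J : ℂ) • z J) * y, ?_⟩
    dsimp only
    rw [← mul_assoc, mul_sum]
    refine congrArg (· * y) (sum_congr rfl fun J hJ => ?_)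
    rw [mul_smul_comm, ← hz J hJ]
  · rintro _ ⟨y, rfl⟩
    refine ⟨((r : ℂ)⁻¹ * (mC cs Set.univ (Simples cs) σ I I : ℂ)) • (e I * y), ?_⟩
    dsimp only
    rw [mul_smul_comm, mul_smul, ← mul_assoc, ← smul_mul_assoc, ← hrI, smul_mul_assoc, smul_smul,
      inv_mul_cancel₀ (by exact_mod_cast hr.ne'), one_smul]

end DPR
end
end

section
/- For 1 ≤ k ≤ n−1 let w_k be the longest element of ⟨s_1,…,s_{k−1}⟩ (the permutation reversing {1,…,k} and fixing the remaining points). Then, as subsets of W = S_n, W^{S∖{s_k}} · w_k = { c_{i₁} c_{i₂} ⋯ c_{i_k} : 1 ≤ i₁ < i₂ < ⋯ < i_k ≤ n }. -/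
open scoped Classical
open MonoidAlgebra Finset Equiv

noncomputable section

namespace DPRSym

variable (n : ℕ)

/-- The simple reflection `s_i` (1-based, `1 ≤ i ≤ n-1`) of the symmetric group
`S_n = Perm (Fin n)`: the transposition of the (0-based) points `i-1` and `i`. -/
def sgen (i : ℕ) : Equiv.Perm (Fin n) :=
  if h : 0 < i ∧ i < n then Equiv.swap ⟨i - 1, by omega⟩ ⟨i, h.2⟩ else 1

/-- The Coxeter generating set `S = {s_1, …, s_{n-1}}` of `S_n`. -/
def Simples : Finset (Equiv.Perm (Fin n)) := (Finset.Icc 1 (n - 1)).image (sgen n)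

/-- The Coxeter length of a permutation: the length of a shortest word in the
generators `S` expressing it. -/
def len (w : Equiv.Perm (Fin n)) : ℕ :=
  sInf {k | ∃ L : List (Equiv.Perm (Fin n)),
    (∀ x ∈ L, x ∈ Simples n) ∧ L.length = k ∧ L.prod = w}

/-- The `i`-cycle `c_i = s_{i-1} ⋯ s_2 s_1` (with `c_1 = 1`). -/
def cgen (i : ℕ) : Equiv.Perm (Fin n) :=
  (((List.range (i - 1)).reverse).map (fun j => sgen n (j + 1))).prod

/-- The set `W^I` of minimal length left coset representatives of `W_I`,
computed inside the subset `H` (take `H = Set.univ` for the absolute case). -/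
def minCoset (H : Set (Equiv.Perm (Fin n))) (I : Finset (Equiv.Perm (Fin n))) :
    Finset (Equiv.Perm (Fin n)) :=
  Finset.univ.filter (fun w => w ∈ H ∧ ∀ s ∈ I, len n w < len n (w * s))

/-- The element `x_I = ∑_{w ∈ W^I} w` of the group algebra. -/
def xRel (H : Set (Equiv.Perm (Fin n))) (I : Finset (Equiv.Perm (Fin n))) :
    MonoidAlgebra ℂ (Equiv.Perm (Fin n)) :=
  ∑ w ∈ minCoset n H I, of ℂ (Equiv.Perm (Fin n)) w

/-- `w(Δ_J) ⊆ Δ_D`: for every `s ∈ J`, `wsw⁻¹ ∈ D` and `ℓ(ws) = ℓ(w) + 1`. -/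
def Takes (D : Finset (Equiv.Perm (Fin n))) (w : Equiv.Perm (Fin n))
    (J : Finset (Equiv.Perm (Fin n))) : Prop :=
  ∀ s ∈ J, w * s * w⁻¹ ∈ D ∧ len n (w * s) = len n w + 1

/-- `ᵂJ = wJw⁻¹`. -/
def conjF (w : Equiv.Perm (Fin n)) (J : Finset (Equiv.Perm (Fin n))) :
    Finset (Equiv.Perm (Fin n)) :=
  J.image (fun s => w * s * w⁻¹)

/-- The coefficient `m_{JK}` (for `σ ≡ 1`: the number of `w ∈ W^K` with
`w(Δ_J) ⊆ Δ`), relative to the pair `(H, D)`. -/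
def mC (H : Set (Equiv.Perm (Fin n))) (D : Finset (Equiv.Perm (Fin n)))
    (J K : Finset (Equiv.Perm (Fin n))) : ℕ :=
  if J ⊆ K then ((minCoset n H K).filter (fun w => Takes n D w J)).card else 0

/-- The family `(e_J)` of BBHT quasi-idempotents for `σ ≡ 1`, relative to `(H, D)`:
the unique solution of the triangular system `x_K = ∑_{J ⊆ K} m_{JK} e_J`, `K ⊆ D`. -/
def IsBBHT (H : Set (Equiv.Perm (Fin n))) (D : Finset (Equiv.Perm (Fin n)))
    (e : Finset (Equiv.Perm (Fin n)) → MonoidAlgebra ℂ (Equiv.Perm (Fin n))) : Prop :=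
  ∀ K ∈ D.powerset, xRel n H K = ∑ J ∈ K.powerset, (mC n H D J K : ℂ) • e J

/-- `b⁺(m, k)`: the coefficient of `t^k` in `(1 - c_1 t)(1 - c_2 t) ⋯ (1 - c_m t)`,
a polynomial with coefficients in the group algebra `ℂ S_n`. -/
def bplus (m k : ℕ) : MonoidAlgebra ℂ (Equiv.Perm (Fin n)) :=
  (((List.range m).map (fun i =>
      1 - Polynomial.C (of ℂ (Equiv.Perm (Fin n)) (cgen n (i + 1))) * Polynomial.X)).prod).coeff k

/-- The transposition of the 0-based points `a` and `b` (junk value `1` if out of range). -/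
def fswap (a b : ℕ) : Equiv.Perm (Fin n) :=
  if h : a < n ∧ b < n then Equiv.swap ⟨a, h.1⟩ ⟨b, h.2⟩ else 1

/-- The values of a simple reflection. -/
lemma sgen_val {a : ℕ} (ha : 0 < a) (han : a < n) (j : Fin n) :
    (sgen n a j : ℕ) = if (j : ℕ) = a - 1 then a else if (j : ℕ) = a then a - 1 else j := by
  rw [sgen, dif_pos ⟨ha, han⟩, Equiv.swap_apply_def]
  simp only [Fin.ext_iff]
  split_ifs <;> rfl

lemma sgen_mul_self (a : ℕ) : sgen n a * sgen n a = 1 := by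
  unfold sgen
  split_ifs <;> simp

/-- Distinct indices give distinct simple reflections. -/
lemma sgen_injOn {a b : ℕ} (ha : 0 < a) (han : a < n) (hb : 0 < b) (hbn : b < n)
    (h : sgen n a = sgen n b) : a = b := by
  have h1 := sgen_val n ha han ⟨a, han⟩
  have h2 := sgen_val n hb hbn ⟨a, han⟩
  rw [h] at h1
  simp only at h1 h2
  split_ifs at h1 h2 <;> omega

lemma mem_Simples {x : Equiv.Perm (Fin n)} :
    x ∈ Simples n ↔ ∃ a, 0 < a ∧ a < n ∧ sgen n a = x := by
  simp only [Simples, Finset.mem_image, Finset.mem_Icc]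
  constructor <;> rintro ⟨a, h, h'⟩
  · exact ⟨a, by omega, by omega, h'⟩
  · exact ⟨a, by omega, h'.2⟩

/-- The simple reflections generate the symmetric group as a monoid. -/
lemma exists_word (w : Equiv.Perm (Fin n)) :
    ∃ L : List (Equiv.Perm (Fin n)), (∀ x ∈ L, x ∈ Simples n) ∧ L.prod = w := by
  rcases n with _ | m
  · exact ⟨[], by simp, Subsingleton.elim _ _⟩
  · have hw : w ∈ Submonoid.closure
        (Set.range fun i : Fin m => Equiv.swap i.castSucc i.succ) := by
      rw [Equiv.Perm.mclosure_swap_castSucc_succ]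
      trivial
    obtain ⟨L, hL, hprod⟩ := Submonoid.exists_list_of_mem_closure hw
    refine ⟨L, fun x hx => ?_, hprod⟩
    obtain ⟨i, rfl⟩ := hL x hx
    refine (mem_Simples _).2 ⟨i + 1, by omega, by omega, ?_⟩
    rw [sgen, dif_pos ⟨by omega, by omega⟩]
    rfl

lemma exists_reduced_word (w : Equiv.Perm (Fin n)) :
    ∃ L : List (Equiv.Perm (Fin n)),
      (∀ x ∈ L, x ∈ Simples n) ∧ L.length = len n w ∧ L.prod = w := by
  obtain ⟨L, hL, hprod⟩ := exists_word n w
  exact Nat.sInf_mem (s := {k | ∃ L : List (Equiv.Perm (Fin n)),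
    (∀ x ∈ L, x ∈ Simples n) ∧ L.length = k ∧ L.prod = w}) ⟨_, L, hL, rfl, hprod⟩

lemma len_prod_le {L : List (Equiv.Perm (Fin n))} (hL : ∀ x ∈ L, x ∈ Simples n) :
    len n L.prod ≤ L.length :=
  Nat.sInf_le ⟨L, hL, rfl, rfl⟩

/-- The exchange condition: if a word in the simple reflections has a descent at `a`,
then multiplying it by `s_a` on the right amounts to deleting one letter. -/
lemma exchange {a : ℕ} (ha : 0 < a) (han : a < n) (L : List (Equiv.Perm (Fin n)))
    (hL : ∀ x ∈ L, x ∈ Simples n)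
    (hdesc : L.prod ⟨a, han⟩ < L.prod ⟨a - 1, by omega⟩) :
    ∃ L' : List (Equiv.Perm (Fin n)), (∀ x ∈ L', x ∈ Simples n) ∧
      L'.length + 1 = L.length ∧ L'.prod = L.prod * sgen n a := by
  induction L with
  | nil =>
    simp only [List.prod_nil, Equiv.Perm.one_apply, Fin.mk_lt_mk] at hdesc
    omega
  | cons x L ih =>
    have hL' : ∀ y ∈ L, y ∈ Simples n := fun y hy => hL y (List.mem_cons_of_mem _ hy)
    by_cases hd : L.prod ⟨a, han⟩ < L.prod ⟨a - 1, by omega⟩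
    · obtain ⟨M, hM, hlen, hprod⟩ := ih hL' hd
      refine ⟨x :: M, ?_, by simp [hlen], by simp [hprod, mul_assoc]⟩
      simpa using ⟨hL x (by simp), hM⟩
    · refine ⟨L, hL', rfl, ?_⟩
      obtain ⟨b, hb, hbn, rfl⟩ := (mem_Simples n).1 (hL x (by simp))
      have hne : (L.prod ⟨a - 1, by omega⟩ : ℕ) ≠ L.prod ⟨a, han⟩ := fun h => by
        have := L.prod.injective (Fin.ext h)
        simp only [Fin.mk.injEq] at this
        omega
      rw [List.prod_cons, Equiv.Perm.mul_apply, Equiv.Perm.mul_apply, Fin.lt_def,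
        sgen_val n hb hbn, sgen_val n hb hbn] at hdesc
      rw [Fin.lt_def] at hd
      have h1 : L.prod ⟨a - 1, by omega⟩ = ⟨b - 1, by omega⟩ := by
        ext
        simp only
        split_ifs at hdesc <;> omega
      have h2 : L.prod ⟨a, han⟩ = ⟨b, hbn⟩ := by
        ext
        simp only
        split_ifs at hdesc <;> omega
      have hconj : sgen n b * L.prod = L.prod * sgen n a := by
        rw [sgen, dif_pos ⟨hb, hbn⟩, sgen, dif_pos ⟨ha, han⟩, ← h1, ← h2,
          Equiv.mul_swap_eq_swap_mul]
      rw [List.prod_cons, hconj, mul_assoc, sgen_mul_self, mul_one]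

lemma len_mul_sgen_lt_of_desc {a : ℕ} (ha : 0 < a) (han : a < n) (w : Equiv.Perm (Fin n))
    (hdesc : w ⟨a, han⟩ < w ⟨a - 1, by omega⟩) : len n (w * sgen n a) < len n w := by
  obtain ⟨L, hL, hlen, rfl⟩ := exists_reduced_word n w
  obtain ⟨M, hM, hlen', hprod⟩ := exchange n ha han L hL hdesc
  have := len_prod_le n hM
  rw [hprod] at this
  omega

/-- Right multiplication by `s_a` increases the length exactly at the ascents. -/
lemma len_lt_len_mul_sgen_iff {a : ℕ} (ha : 0 < a) (han : a < n) (w : Equiv.Perm (Fin n)) :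
    len n w < len n (w * sgen n a) ↔ w ⟨a - 1, by omega⟩ < w ⟨a, han⟩ := by
  constructor
  · intro h
    by_contra hlt
    have hne : w ⟨a, han⟩ ≠ w ⟨a - 1, by omega⟩ := fun h => by
      have := w.injective h
      simp only [Fin.mk.injEq] at this
      omega
    have := len_mul_sgen_lt_of_desc n ha han w (lt_of_le_of_ne (not_lt.1 hlt) hne)
    omega
  · intro h
    have h1 : sgen n a ⟨a, han⟩ = ⟨a - 1, by omega⟩ := by
      rw [sgen, dif_pos ⟨ha, han⟩, Equiv.swap_apply_right]
    have h2 : sgen n a ⟨a - 1, by omega⟩ = ⟨a, han⟩ := by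
      rw [sgen, dif_pos ⟨ha, han⟩, Equiv.swap_apply_left]
    have := len_mul_sgen_lt_of_desc n ha han (w * sgen n a)
      (by rwa [Equiv.Perm.mul_apply, Equiv.Perm.mul_apply, h1, h2])
    rwa [mul_assoc, sgen_mul_self, mul_one] at this

/-- The minimal coset representatives for `S ∖ {s_k}` are the permutations that are increasing
on the first `k` points and on the remaining ones. -/
lemma mem_minCoset_iff {k : ℕ} (hk1 : 0 < k) (hk : k < n) (w : Equiv.Perm (Fin n)) :
    w ∈ minCoset n Set.univ (Simples n \ {sgen n k}) ↔
      ∀ i j : Fin n, i < j → ((j : ℕ) < k ∨ k ≤ (i : ℕ)) → w i < w j := by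
  simp only [minCoset, Finset.mem_filter, Finset.mem_univ, Set.mem_univ, true_and,
    Finset.mem_sdiff, Finset.mem_singleton, mem_Simples]
  constructor
  · intro h
    have hstep : ∀ a (ha : 0 < a) (han : a < n), a ≠ k →
        w ⟨a - 1, by omega⟩ < w ⟨a, han⟩ := fun a ha han hak =>
      (len_lt_len_mul_sgen_iff n ha han w).1
        (h _ ⟨⟨a, ha, han, rfl⟩, fun he => hak (sgen_injOn n ha han hk1 hk he)⟩)
    rintro ⟨i, hi⟩ ⟨j, hj⟩ hij hblock
    simp only [Fin.mk_lt_mk] at hij hblock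
    induction j with
    | zero => omega
    | succ j ih =>
      have hlast := hstep (j + 1) (by omega) hj (by omega)
      rcases (Nat.lt_succ_iff.1 hij).eq_or_lt with rfl | hlt
      · exact hlast
      · exact (ih (by omega) (by omega) hlt).trans hlast
  · rintro h s ⟨⟨a, ha, han, rfl⟩, hne⟩
    have hak : a ≠ k := fun he => hne (he ▸ rfl)
    refine (len_lt_len_mul_sgen_iff n ha han w).2 (h _ _ ?_ ?_)
    · rw [Fin.mk_lt_mk]
      omega
    · simp only
      omega

/-- The values of the cycle `c_i`. -/
lemma cgen_val {a : ℕ} (ha : 0 < a) (han : a ≤ n) (j : Fin n) :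
    (cgen n a j : ℕ) = if (j : ℕ) = 0 then a - 1 else if (j : ℕ) < a then j - 1 else j := by
  induction a, ha using Nat.le_induction with
  | base =>
    simp only [cgen, Nat.succ_eq_add_one, Nat.zero_add, Nat.sub_self, List.range_zero,
      List.reverse_nil, List.map_nil, List.prod_nil, Equiv.Perm.one_apply]
    split_ifs <;> omega
  | succ a ha ih =>
    have hrec : cgen n (a + 1) = sgen n a * cgen n a := by
      obtain ⟨b, rfl⟩ := Nat.exists_eq_add_of_le' ha
      simp [cgen, List.range_succ]
    rw [hrec, Equiv.Perm.mul_apply, sgen_val n ha (by omega), ih (by omega)]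
    split_ifs <;> omega

/-- The permutation `x` is decreasing on the first `k` points, increasing on the remaining ones,
and maps the first `k` points onto the (1-based) points satisfying `P`. -/
structure IsDecInc (k : ℕ) (P : ℕ → Prop) (x : Equiv.Perm (Fin n)) : Prop where
  image : ∀ j : Fin n, (j : ℕ) < k ↔ P (x j + 1)
  dec : ∀ i j : Fin n, i < j → (j : ℕ) < k → x j < x i
  inc : ∀ i j : Fin n, i < j → k ≤ (i : ℕ) → x i < x j

lemma IsDecInc.eq {k : ℕ} {P : ℕ → Prop} {x y : Equiv.Perm (Fin n)}
    (hx : IsDecInc n k P x) (hy : IsDecInc n k P y) : x = y := by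
  have happ : ∀ j, y ((y⁻¹ * x) j) = x j := fun j => by simp
  have hblock : ∀ j, ((y⁻¹ * x) j : ℕ) < k ↔ (j : ℕ) < k := fun j => by
    rw [hx.image j, hy.image, happ]
  have hmono : StrictMono (y⁻¹ * x) := by
    intro i j hij
    have hi := hblock i
    have hj := hblock j
    by_contra hlt
    have hne : (y⁻¹ * x) j ≠ (y⁻¹ * x) i := fun h => hij.ne' ((y⁻¹ * x).injective h)
    have hji : (y⁻¹ * x) j < (y⁻¹ * x) i := lt_of_le_of_ne (not_lt.1 hlt) hne
    rw [Fin.lt_def] at hij hji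
    by_cases hjk : (j : ℕ) < k
    · have h1 := hx.dec i j hij hjk
      have h2 := hy.dec _ _ hji (hi.2 (by omega))
      rw [happ, happ] at h2
      exact lt_asymm h1 h2
    · by_cases hik : (i : ℕ) < k
      · have := hi.2 hik
        have := mt hj.1 hjk
        omega
      · have h1 := hx.inc i j hij (not_lt.1 hik)
        have h2 := hy.inc _ _ hji (not_lt.1 (mt hj.1 hjk))
        rw [happ, happ] at h2
        exact lt_asymm h1 h2
  have hid : ((y⁻¹ * x : Equiv.Perm (Fin n)) : Fin n → Fin n) = id :=
    hmono.eq_id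
  ext j
  rw [← happ j, hid, id]

/-- A product `c_{i₁} ⋯ c_{i_k}` with `i₁ < ⋯ < i_k` is decreasing on the first `k` points,
which it maps onto `{i₁, …, i_k}`, and increasing on the others. -/
lemma isDecInc_prod_cgen (l : List ℕ) (hl : l.Pairwise (· < ·))
    (hmem : ∀ a ∈ l, 0 < a ∧ a ≤ n) :
    IsDecInc n l.length (· ∈ l) (l.map (cgen n)).prod := by
  induction l with
  | nil => exact ⟨by simp, by simp, by simp⟩
  | cons a l ih =>
    obtain ⟨hal, hl⟩ := List.pairwise_cons.1 hl
    obtain ⟨ha, han⟩ := hmem a (by simp)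
    have hy := ih hl fun b hb => hmem b (List.mem_cons_of_mem _ hb)
    set y := (l.map (cgen n)).prod
    have hval : ∀ j, (((a :: l).map (cgen n)).prod j : ℕ) =
        if (y j : ℕ) = 0 then a - 1 else if (y j : ℕ) < a then y j - 1 else y j := fun j => by
      rw [List.map_cons, List.prod_cons, Equiv.Perm.mul_apply, cgen_val n ha han]
    have hlt : ∀ j : Fin n, (j : ℕ) < l.length → a ≤ y j := fun j hj => by
      have := hal _ ((hy.image j).1 hj)
      omega
    have hzero : ∀ j : Fin n, (j : ℕ) = l.length → (y j : ℕ) = 0 := fun j hj => by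
      obtain ⟨m, hm⟩ := y.surjective ⟨0, by omega⟩
      have hm0 : (y m : ℕ) = 0 := by rw [hm]
      have hmj : ¬ (m : ℕ) < j := fun h => by
        have := hlt m (by omega)
        omega
      rcases (not_lt.1 hmj).eq_or_lt with h | h
      · rw [Fin.ext h, hm0]
      · have := hy.inc j m h hj.ge
        rw [Fin.lt_def] at this
        omega
    have hpos : ∀ j : Fin n, l.length < (j : ℕ) → 0 < (y j : ℕ) := fun j hj => by
      have := hy.inc ⟨l.length, by omega⟩ j hj le_rfl
      rw [Fin.lt_def] at this
      omega
    refine ⟨fun j => ?_, fun i j hij hj => ?_, fun i j hij hi => ?_⟩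
    · have him := hy.image j
      rw [List.length_cons, List.mem_cons, hval]
      rcases lt_trichotomy (j : ℕ) l.length with h | h | h
      · have := hlt j h
        rw [if_neg (by omega), if_neg (by omega)]
        exact iff_of_true (by omega) (Or.inr (him.1 h))
      · rw [if_pos (hzero j h)]
        exact iff_of_true (by omega) (Or.inl (by omega))
      · have := hpos j h
        rw [if_neg (by omega)]
        refine iff_of_false (by omega) ?_
        split_ifs with hja
        · rintro (h' | h')
          · omega
          · have := hal _ h'
            omega
        · rintro (h' | h')
          · omega
          · have := him.2 h'
            omega
    · rw [List.length_cons] at hj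
      rw [Fin.lt_def] at hij
      rw [Fin.lt_def, hval, hval]
      have h1 := hlt i (by omega)
      rw [if_neg (by omega : ¬ (y i : ℕ) = 0), if_neg (by omega : ¬ (y i : ℕ) < a)]
      rcases (Nat.lt_succ_iff.1 hj).eq_or_lt with h | h
      · rw [if_pos (hzero j h)]
        omega
      · have h2 := hlt j h
        have h3 := hy.dec i j hij h
        rw [Fin.lt_def] at h3
        rwa [if_neg (by omega), if_neg (by omega)]
    · rw [List.length_cons] at hi
      rw [Fin.lt_def] at hij
      have h1 := hpos i (by omega)
      have h2 := hy.inc i j hij (by omega)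
      rw [Fin.lt_def] at h2 ⊢
      rw [hval, hval]
      split_ifs <;> omega

lemma isDecInc_prod_sort {t : Finset ℕ} (ht : t ⊆ Finset.Icc 1 n) :
    IsDecInc n t.card (· ∈ t) ((t.sort (· ≤ ·)).map (cgen n)).prod := by
  have h := isDecInc_prod_cgen n (t.sort (· ≤ ·)) t.sortedLT_sort.pairwise
    fun a ha => Finset.mem_Icc.1 (ht ((Finset.mem_sort _).1 ha))
  simpa only [Finset.length_sort, Finset.mem_sort] using h

/-- Lemma 5.2: for `1 ≤ k ≤ n-1`, with `w_k` the longest element of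
`⟨s_1, …, s_{k-1}⟩` (the permutation reversing `{1, …, k}` and fixing the other
points), one has `W^{S∖{s_k}} w_k = { c_{i₁} ⋯ c_{i_k} : 1 ≤ i₁ < ⋯ < i_k ≤ n }`. -/
theorem stmt10 (hn : 2 ≤ n) (k : ℕ) (hk1 : 1 ≤ k) (hk : k ≤ n - 1)
    (wk : Equiv.Perm (Fin n))
    (hwk : ∀ j : Fin n,
      ((wk j : ℕ) = if (j : ℕ) < k then k - 1 - (j : ℕ) else (j : ℕ))) :
    (((minCoset n Set.univ (Simples n \ {sgen n k})).image (fun w => w * wk)) :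
        Set (Equiv.Perm (Fin n)))
      = {x | ∃ t : Finset ℕ, t ⊆ Finset.Icc 1 n ∧ t.card = k ∧
          x = ((t.sort (· ≤ ·)).map (cgen n)).prod} := by
  have hk1' : 0 < k := hk1
  have hkn : k < n := by omega
  have hwk2 : ∀ j, wk (wk j) = j := fun j => by
    ext
    rw [hwk, hwk]
    split_ifs <;> omega
  have hwkinv : wk * wk = 1 := Equiv.ext hwk2
  ext x
  simp only [Finset.coe_image, Set.mem_image, Finset.mem_coe, Set.mem_ofPred_eq,
    mem_minCoset_iff n hk1' hkn]
  constructor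
  · rintro ⟨w, hw, rfl⟩
    set t : Finset ℕ := (Finset.univ.filter fun j : Fin n => (j : ℕ) < k).image
      fun j => (w j : ℕ) + 1 with ht_def
    have hinj : Function.Injective fun j => (w j : ℕ) + 1 := fun i j h =>
      w.injective (Fin.ext (Nat.succ_injective h))
    have ht : t ⊆ Finset.Icc 1 n := fun a ha => by
      obtain ⟨j, -, rfl⟩ := Finset.mem_image.1 ha
      exact Finset.mem_Icc.2 ⟨by omega, by omega⟩
    have hcard : t.card = k := by
      rw [ht_def, Finset.card_image_of_injective _ hinj, Fin.card_filter_val_lt]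
      omega
    have hmem : ∀ j : Fin n, (w j : ℕ) + 1 ∈ t ↔ (j : ℕ) < k := fun j => by
      rw [ht_def, hinj.mem_finset_image]
      simp
    refine ⟨t, ht, hcard, IsDecInc.eq n (k := k) (P := (· ∈ t)) ⟨fun j => ?_, fun i j hij hj => ?_,
      fun i j hij hi => ?_⟩ (hcard ▸ isDecInc_prod_sort n ht)⟩
    · rw [Equiv.Perm.mul_apply, hmem, hwk]
      split_ifs <;> omega
    all_goals
      rw [Fin.lt_def] at hij
      refine hw _ _ ?_ ?_
      · rw [Fin.lt_def, hwk, hwk]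
        split_ifs <;> omega
      · rw [hwk, hwk]
        split_ifs <;> omega
  · rintro ⟨t, ht, rfl, rfl⟩
    have hx := isDecInc_prod_sort n ht
    refine ⟨_ * wk, fun i j hij hblock => ?_, by rw [mul_assoc, hwkinv, mul_one]⟩
    rw [Fin.lt_def] at hij
    have hi := hwk i
    have hj := hwk j
    rcases hblock with hjk | hik
    · rw [if_pos (by omega)] at hi hj
      exact hx.dec _ _ (Fin.lt_def.2 (by omega)) (by omega)
    · rw [if_neg (by omega)] at hi hj
      exact hx.inc _ _ (Fin.lt_def.2 (by omega)) (by omega)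

end DPRSym
end
end
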